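/- η(μ)²/4 is the best Hardy constant both near the origin and near infinity in the half-space (Theorem 6.1(2) for Ω = ℝⁿ₊): let n ≥ 2, μ ≤ 1/4, η(μ) := n − 1 + √(1 − 4μ), and fix R > 0. If λ ∈ ℝ is such that ∫ |∇φ|² dx − μ ∫ φ²/x₁² dx ≥ λ ∫ φ²/|x|² dx holds for every φ ∈ C_c^∞(ℝⁿ₊) with support contained in the open ball B(0,R), then λ ≤ η(μ)²/4. Likewise, if the inequality holds for every φ ∈ C_c^∞(ℝⁿ₊) with support contained in ℝⁿ ∖ closure(B(0,R)), then λ ≤ η(μ)²/4. -/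

import Mathlib

open MeasureTheory

noncomputable section

/-- Test functions: smooth compactly supported functions with support in `Ω`. -/
def IsTestFun {n : ℕ} (Ω : Set (EuclideanSpace ℝ (Fin n)))
    (φ : EuclideanSpace ℝ (Fin n) → ℝ) : Prop :=
  ContDiff ℝ (⊤ : ℕ∞) φ ∧ HasCompactSupport φ ∧ tsupport φ ⊆ Ω

/-- The open half-space `{x ∈ ℝⁿ : x₁ > 0}`. -/
def Hplus (n : ℕ) [NeZero n] : Set (EuclideanSpace ℝ (Fin n)) := {x | 0 < x 0}

/-- Polar coordinates for functions of product form. -/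
lemma polar_prod {n : ℕ} [NeZero n] (A B : ℝ → ℝ) :
    ∫ x : EuclideanSpace ℝ (Fin n), A ‖x‖ * B (x 0 / ‖x‖) =
      (∫ r in Set.Ioi (0:ℝ), r ^ (n - 1) * A r) *
        ∫ θ : Metric.sphere (0 : EuclideanSpace ℝ (Fin n)) 1, B (θ.1 0)
          ∂((volume : Measure (EuclideanSpace ℝ (Fin n))).toSphere) := by
  set μ := (volume : Measure (EuclideanSpace ℝ (Fin n))) with hμ
  have hdim : Module.finrank ℝ (EuclideanSpace ℝ (Fin n)) = n := by simp
  have : Nontrivial (EuclideanSpace ℝ (Fin n)) := by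
    apply Module.nontrivial_of_finrank_pos (R := ℝ)
    rw [hdim]; exact Nat.pos_of_ne_zero (NeZero.ne n)
  calc
    ∫ x : EuclideanSpace ℝ (Fin n), A ‖x‖ * B (x 0 / ‖x‖)
      = ∫ x : ({(0)}ᶜ : Set (EuclideanSpace ℝ (Fin n))), A ‖x.1‖ * B (x.1 0 / ‖x.1‖)
          ∂(μ.comap (↑)) := by
      rw [integral_subtype_comap (measurableSet_singleton _).compl
        fun x : EuclideanSpace ℝ (Fin n) ↦ A ‖x‖ * B (x 0 / ‖x‖),
        restrict_compl_singleton]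
    _ = ∫ x, B (x.1.1 0) * A x.2 ∂μ.toSphere.prod (.volumeIoiPow (n - 1)) := by
      have := μ.measurePreserving_homeomorphUnitSphereProd.integral_comp
        (Homeomorph.measurableEmbedding _) (fun x => B (x.1.1 0) * A x.2)
      rw [hdim] at this
      rw [← this]
      congr 1
      ext x
      simp [mul_comm, div_eq_inv_mul]
    _ = (∫ θ, B (θ.1 0) ∂μ.toSphere) * ∫ x : Set.Ioi (0 : ℝ), A x ∂.volumeIoiPow (n - 1) :=
      integral_prod_mul (fun θ : Metric.sphere (0 : EuclideanSpace ℝ (Fin n)) 1 => B (θ.1 0))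
        (fun x : Set.Ioi (0 : ℝ) => A x)
    _ = _ := by
      rw [mul_comm]
      congr 1
      simp only [Measure.volumeIoiPow, ENNReal.ofReal]
      rw [integral_withDensity_eq_integral_smul,
        integral_subtype_comap measurableSet_Ioi fun a ↦ Real.toNNReal (a ^ (n - 1)) • A a,
        setIntegral_congr_fun measurableSet_Ioi fun x hx ↦ ?_]
      · simp only [NNReal.smul_def, Real.coe_toNNReal _ (pow_nonneg hx.out.le _), smul_eq_mul]
      · exact (measurable_subtype_coe.pow_const _).real_toNNReal

open scoped Pointwise in
lemma strip_bound {n : ℕ} [NeZero n] (δ : ℝ) (hδ : 0 < δ) :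
    ((volume : Measure (EuclideanSpace ℝ (Fin n))).toSphere).real
      {θ : Metric.sphere (0 : EuclideanSpace ℝ (Fin n)) 1 | 0 ≤ θ.1 0 ∧ θ.1 0 ≤ δ} ≤
      (n * 2 ^ (n - 1)) * δ := by
  have hms : MeasurableSet
      {θ : Metric.sphere (0 : EuclideanSpace ℝ (Fin n)) 1 | 0 ≤ θ.1 0 ∧ θ.1 0 ≤ δ} := by
    apply IsClosed.measurableSet
    have hc : Continuous (fun θ : Metric.sphere (0 : EuclideanSpace ℝ (Fin n)) 1 => θ.1 0) := by
      fun_prop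
    exact (isClosed_le continuous_const hc).inter (isClosed_le hc continuous_const)
  rw [measureReal_def, Measure.toSphere_apply' _ hms]
  let a : Fin n → ℝ := fun i => if i = 0 then 0 else -1
  let b : Fin n → ℝ := fun i => if i = 0 then δ else 1
  have hsub : (Set.Ioo (0:ℝ) 1 • (Subtype.val ''
      {θ : Metric.sphere (0 : EuclideanSpace ℝ (Fin n)) 1 | 0 ≤ θ.1 0 ∧ θ.1 0 ≤ δ}) :
        Set (EuclideanSpace ℝ (Fin n))) ⊆ (@WithLp.ofLp 2 (Fin n → ℝ)) ⁻¹' (Set.Icc a b) := by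
    rintro x ⟨t, ht, y, ⟨θ, hθ, rfl⟩, rfl⟩
    have hn1 : ‖θ.1‖ = 1 := by simpa using θ.2
    have hi : ∀ i, |θ.1 i| ≤ 1 := fun i => by
      have := PiLp.norm_apply_le θ.1 i
      rw [hn1] at this; simpa using this
    have h1 : ∀ i, t * θ.1 i ≤ 1 := fun i => by
      have := abs_le.1 (hi i); nlinarith [ht.1, ht.2]
    have h2 : ∀ i, -1 ≤ t * θ.1 i := fun i => by
      have := abs_le.1 (hi i); nlinarith [ht.1, ht.2]
    have h3 : 0 ≤ t * θ.1 0 := mul_nonneg ht.1.le hθ.1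
    have h4 : t * θ.1 0 ≤ δ := by nlinarith [ht.1, ht.2, hθ.1, hθ.2]
    refine ⟨fun i => ?_, fun i => ?_⟩
    · by_cases h : i = 0
      · subst h; simpa [a] using h3
      · simpa [a, h] using h2 i
    · by_cases h : i = 0
      · subst h; simpa [b] using h4
      · simpa [b, h] using h1 i
  have hvol : (volume : Measure (EuclideanSpace ℝ (Fin n)))
      ((@WithLp.ofLp 2 (Fin n → ℝ)) ⁻¹' (Set.Icc a b)) = ENNReal.ofReal (δ * 2 ^ (n - 1)) := by
    rw [(PiLp.volume_preserving_ofLp (Fin n)).measure_preimage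
      measurableSet_Icc.nullMeasurableSet, Real.volume_Icc_pi,
      ← ENNReal.ofReal_prod_of_nonneg]
    · congr 1
      rw [← Finset.mul_prod_erase _ _ (Finset.mem_univ (0 : Fin n))]
      rw [Finset.prod_congr rfl (g := fun _ => (2:ℝ))]
      · simp [a, b]
      · intro i hi
        have := (Finset.mem_erase.1 hi).1
        simp [a, b, this]; norm_num
    · intro i _
      by_cases h : i = 0
      · simp [a, b, h, hδ.le]
      · simp [a, b, h]; 
  have hle := (measure_mono hsub).trans hvol.le
  calc _ ≤ ((n : ENNReal) * ENNReal.ofReal (δ * 2 ^ (n - 1))).toReal := by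
        apply ENNReal.toReal_mono
        · exact ENNReal.mul_ne_top (by simp) (by simp)
        · simp only [finrank_euclideanSpace, Fintype.card_fin]
          gcongr
    _ = _ := by
        rw [ENNReal.toReal_mul, ENNReal.toReal_ofReal (by positivity)]
        simp; ring

lemma sphere_cutoff {n : ℕ} [NeZero n] (β : ℝ) (hβ : 1 / 2 < β) :
    ∃ c : ℝ, 0 < c ∧ ∀ τ : ℝ, 0 < τ → ∃ (g : ℝ → ℝ) (ε : ℝ), ContDiff ℝ (⊤ : ℕ∞) g ∧ 0 < ε ∧
      (∀ s ≤ ε, g s = 0) ∧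
      c ≤ ∫ θ : Metric.sphere (0 : EuclideanSpace ℝ (Fin n)) 1, (θ.1 0) ^ (2 * β) * g (θ.1 0) ^ 2
          ∂((volume : Measure (EuclideanSpace ℝ (Fin n))).toSphere) ∧
      ∫ θ : Metric.sphere (0 : EuclideanSpace ℝ (Fin n)) 1,
        (θ.1 0) ^ (2 * β) * deriv g (θ.1 0) ^ 2
          ∂((volume : Measure (EuclideanSpace ℝ (Fin n))).toSphere) ≤ τ := by
  set σ := ((volume : Measure (EuclideanSpace ℝ (Fin n))).toSphere) with hσ
  have hc0 : Continuous (fun θ : Metric.sphere (0 : EuclideanSpace ℝ (Fin n)) 1 => θ.1 0) := by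
    fun_prop
  set U : Set (Metric.sphere (0 : EuclideanSpace ℝ (Fin n)) 1) := {θ | 1 / 2 < θ.1 0} with hU
  have hUo : IsOpen U := isOpen_lt continuous_const hc0
  have hUne : U.Nonempty := by
    refine ⟨⟨EuclideanSpace.single 0 1, by simp⟩, ?_⟩
    simp [hU]; norm_num
  have hUpos : 0 < σ.real U := by
    rw [measureReal_def]
    exact ENNReal.toReal_pos (hUo.measure_pos σ hUne).ne' (measure_ne_top _ _)
  -- bound on derivative of the smooth transition
  obtain ⟨M, hM⟩ : ∃ M : ℝ, ∀ s, |deriv Real.smoothTransition s| ≤ M := by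
    have hcont : Continuous (deriv Real.smoothTransition) :=
      (Real.smoothTransition.contDiff (n := 1)).continuous_deriv le_rfl
    obtain ⟨M, hM⟩ := (isCompact_Icc (a := (0:ℝ)) (b := 1)).exists_bound_of_continuousOn
      hcont.continuousOn
    refine ⟨max M 0, fun s => ?_⟩
    by_cases h : s ∈ Set.Icc (0:ℝ) 1
    · exact (hM s h).trans (le_max_left _ _)
    · have : deriv Real.smoothTransition s = 0 := by
        rw [Set.mem_Icc, not_and_or, not_le, not_le] at h
        rcases h with h | h
        · have : Real.smoothTransition =ᶠ[nhds s] fun _ => 0 := by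
            filter_upwards [Iio_mem_nhds h] with x hx
            exact Real.smoothTransition.zero_of_nonpos (le_of_lt hx)
          rw [this.deriv_eq]; simp
        · have : Real.smoothTransition =ᶠ[nhds s] fun _ => 1 := by
            filter_upwards [Ioi_mem_nhds h] with x hx
            exact Real.smoothTransition.one_of_one_le (le_of_lt hx)
          rw [this.deriv_eq]; simp
      rw [this]; simp
  have hM0 : 0 ≤ M := (abs_nonneg _).trans (hM 0)
  refine ⟨(1/2) ^ (2 * β) * σ.real U, by positivity, fun τ hτ => ?_⟩
  -- choose ε
  obtain ⟨ε, hε, hε4, hετ⟩ : ∃ ε : ℝ, 0 < ε ∧ ε ≤ 1 / 4 ∧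
      (2 * ε) ^ (2 * β) * (M / ε) ^ 2 * (n * 2 ^ (n - 1) * (2 * ε)) ≤ τ := by
    have ht : Filter.Tendsto (fun ε : ℝ => (2 ^ (2 * β) * M ^ 2 * (n * 2 ^ (n - 1) * 2)) *
        ε ^ (2 * β - 1)) (nhdsWithin 0 (Set.Ioi 0)) (nhds 0) := by
      have h1 : Filter.Tendsto (fun ε : ℝ => ε ^ (2 * β - 1)) (nhds 0) (nhds 0) := by
        have := (Real.continuousAt_rpow_const 0 (2 * β - 1) (Or.inr (by linarith))).tendsto
        rwa [Real.zero_rpow (by linarith)] at this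
      have := (h1.mono_left (nhdsWithin_le_nhds (s := Set.Ioi 0))).const_mul
        (2 ^ (2 * β) * M ^ 2 * (n * 2 ^ (n - 1) * 2))
      simpa using this
    have h1 := ht.eventually (ge_mem_nhds hτ)
    have h2 : ∀ᶠ ε : ℝ in nhdsWithin 0 (Set.Ioi 0), ε ≤ 1 / 4 :=
      nhdsWithin_le_nhds (ge_mem_nhds (by norm_num))
    obtain ⟨ε, ⟨h1, h2⟩, h3⟩ := ((h1.and h2).and self_mem_nhdsWithin).exists
    have h3 : 0 < ε := h3
    refine ⟨ε, h3, h2, le_trans (le_of_eq ?_) h1⟩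
    rw [Real.mul_rpow (by norm_num) h3.le, Real.rpow_sub_one h3.ne']
    field_simp
  set g : ℝ → ℝ := fun s => Real.smoothTransition (s / ε - 1) with hg
  have hgs : ContDiff ℝ (⊤ : ℕ∞) g := by
    apply Real.smoothTransition.contDiff.comp
    fun_prop
  have hg0 : ∀ s ≤ ε, g s = 0 := fun s hs =>
    Real.smoothTransition.zero_of_nonpos (by rw [sub_nonpos, div_le_one hε]; exact hs)
  have hg1 : ∀ s, 2 * ε ≤ s → g s = 1 := fun s hs =>
    Real.smoothTransition.one_of_one_le (by
      have : 2 ≤ s / ε := by rw [le_div_iff₀ hε]; exact hs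
      linarith)
  have hgd : ∀ s, deriv g s = deriv Real.smoothTransition (s / ε - 1) * (1 / ε) := fun s => by
    have h1 : HasDerivAt Real.smoothTransition (deriv Real.smoothTransition (s / ε - 1))
      (s / ε - 1) := 
      ((Real.smoothTransition.contDiff (n := 1)).differentiable (by norm_num) _).hasDerivAt
    have h2 : HasDerivAt (fun s : ℝ => s / ε - 1) (1 / ε) s :=
      ((hasDerivAt_id s).div_const ε).sub_const 1
    exact (h1.comp s h2).deriv
  have hgd0 : ∀ s < ε, deriv g s = 0 := fun s hs => by
    have : g =ᶠ[nhds s] fun _ => 0 := by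
      filter_upwards [Iio_mem_nhds hs] with x hx
      exact hg0 x (le_of_lt hx)
    rw [this.deriv_eq]; simp
  have hgd1 : ∀ s, 2 * ε < s → deriv g s = 0 := fun s hs => by
    have : g =ᶠ[nhds s] fun _ => 1 := by
      filter_upwards [Ioi_mem_nhds hs] with x hx
      exact hg1 x (le_of_lt hx)
    rw [this.deriv_eq]; simp
  have hpow : Continuous (fun s : ℝ => s ^ (2 * β)) :=
    Real.continuous_rpow_const (by linarith)
  have hgcd : Continuous (deriv g) := (hgs.of_le (by simp : (1 : WithTop ℕ∞) ≤ _)).continuous_deriv le_rfl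
  have hIntF : ∀ F : ℝ → ℝ, Continuous F → Integrable
      (fun θ : Metric.sphere (0 : EuclideanSpace ℝ (Fin n)) 1 => F (θ.1 0)) σ := fun F hF =>
    (hF.comp hc0).integrable_of_hasCompactSupport (HasCompactSupport.of_compactSpace _)
  refine ⟨g, ε, hgs, hε, hg0, ?_, ?_⟩
  · calc (1/2) ^ (2 * β) * σ.real U = ∫ θ, U.indicator (fun _ => (1/2 : ℝ) ^ (2 * β)) θ ∂σ := by
          rw [integral_indicator_const _ hUo.measurableSet]; simp [mul_comm]
      _ ≤ _ := by
          apply integral_mono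
          · exact (integrable_const _).indicator hUo.measurableSet
          · exact hIntF (fun s => s ^ (2 * β) * g s ^ 2) (hpow.mul (hgs.continuous.pow 2))
          · intro θ
            by_cases h : θ ∈ U
            · have h' : 1 / 2 < θ.1 0 := h
              simp only [Set.indicator_of_mem h]
              rw [hg1 _ (by linarith)]
              simp only [one_pow, mul_one]
              exact Real.rpow_le_rpow (by norm_num) h'.le (by linarith)
            · simp only [Set.indicator_of_notMem h]
              by_cases h2 : θ.1 0 ≤ ε
              · rw [hg0 _ h2]; simp
              · have : 0 < θ.1 0 := by linarith
                positivity
  · set S : Set (Metric.sphere (0 : EuclideanSpace ℝ (Fin n)) 1) :=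
      {θ | 0 ≤ θ.1 0 ∧ θ.1 0 ≤ 2 * ε} with hS
    have hSm : MeasurableSet S :=
      ((isClosed_le continuous_const hc0).inter (isClosed_le hc0 continuous_const)).measurableSet
    calc _ ≤ ∫ θ, S.indicator (fun _ => (2 * ε) ^ (2 * β) * (M / ε) ^ 2) θ ∂σ := by
          apply integral_mono
          · exact hIntF (fun s => s ^ (2 * β) * deriv g s ^ 2) (hpow.mul (hgcd.pow 2))
          · exact (integrable_const _).indicator hSm
          · intro θ
            by_cases h : θ ∈ S
            · simp only [Set.indicator_of_mem h]
              have h1 : |deriv g (θ.1 0)| ≤ M / ε := by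
                rw [hgd, abs_mul, abs_of_pos (by positivity : 0 < 1 / ε), mul_one_div]
                exact div_le_div_of_nonneg_right (hM _) hε.le
              have h2 : deriv g (θ.1 0) ^ 2 ≤ (M / ε) ^ 2 := by
                rw [← sq_abs]; gcongr
              have h3 := Real.rpow_le_rpow h.1 h.2 (by linarith : 0 ≤ 2 * β)
              exact mul_le_mul h3 h2 (sq_nonneg _) (by positivity)
            · simp only [Set.indicator_of_notMem h]
              have : deriv g (θ.1 0) = 0 := by
                by_cases h2 : θ.1 0 < ε
                · exact hgd0 _ h2
                · apply hgd1
                  by_contra h3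
                  exact h ⟨by linarith, by linarith⟩
              rw [this]; simp
      _ = σ.real S * ((2 * ε) ^ (2 * β) * (M / ε) ^ 2) := by
          rw [integral_indicator_const _ hSm]; simp
      _ ≤ (n * 2 ^ (n - 1) * (2 * ε)) * ((2 * ε) ^ (2 * β) * (M / ε) ^ 2) := by
          gcongr
          exact strip_bound (2 * ε) (by linarith)
      _ ≤ τ := by rw [mul_comm]; exact hετ

lemma integral_Ioi_exp (G : ℝ → ℝ) :
    ∫ r in Set.Ioi (0:ℝ), G r = ∫ t : ℝ, Real.exp t * G (Real.exp t) := by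
  have := integral_image_eq_integral_abs_deriv_smul (s := Set.univ) (f := Real.exp)
    (f' := Real.exp) MeasurableSet.univ (fun x _ => (Real.hasDerivAt_exp x).hasDerivWithinAt)
    Real.exp_injective.injOn G
  rw [Set.image_univ, Real.range_exp, setIntegral_univ] at this
  simpa [abs_of_pos (Real.exp_pos _)] using this

lemma integral_affine (F : ℝ → ℝ) (T k : ℝ) (hk : 0 < k) :
    ∫ t : ℝ, F ((t - T) / k) = k * ∫ t : ℝ, F t := by
  rw [integral_sub_right_eq_self (fun t => F (t / k)) T, Measure.integral_comp_div F k,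
    abs_of_pos hk, smul_eq_mul]

lemma radial_cutoff (α τ : ℝ) (hτ : 0 < τ) :
    ∃ k : ℝ, 0 < k ∧ ∀ T : ℝ, ∃ p : ℝ → ℝ, ContDiffOn ℝ (⊤ : ℕ∞) p (Set.Ioi 0) ∧
      (∀ r, 0 < r → r ∉ Set.Icc (Real.exp (T - k)) (Real.exp (T + k)) → p r = 0) ∧
      0 < ∫ r in Set.Ioi (0:ℝ), r ^ (2 * α - 1) * p r ^ 2 ∧
      ∫ r in Set.Ioi (0:ℝ), r ^ (2 * α + 1) * deriv p r ^ 2 ≤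
        (α ^ 2 + τ) * ∫ r in Set.Ioi (0:ℝ), r ^ (2 * α - 1) * p r ^ 2 := by
  let f : ContDiffBump (0:ℝ) := ⟨1/2, 1, by norm_num, by norm_num⟩
  have hfs : ContDiff ℝ (⊤ : ℕ∞) f := f.contDiff
  have hfd : ∀ t, HasDerivAt f (deriv f t) t := fun t =>
    (hfs.differentiable (by simp) t).hasDerivAt
  have hfc : Continuous f := hfs.continuous
  have hfc' : Continuous (deriv f) := (hfs.of_le (by simp : (1 : WithTop ℕ∞) ≤ _)).continuous_deriv le_rfl
  have hsup : HasCompactSupport f := f.hasCompactSupport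
  have hsup' : HasCompactSupport (deriv f) := hsup.deriv
  have i1 : Integrable (fun t => f t ^ 2) := by
    refine (hfc.pow 2).integrable_of_hasCompactSupport ?_
    simpa only [pow_two] using hsup.mul_left (f := f)
  have i2 : Integrable (fun t => deriv f t ^ 2) := by
    refine (hfc'.pow 2).integrable_of_hasCompactSupport ?_
    simpa only [pow_two] using hsup'.mul_left (f := deriv f)
  have i3 : Integrable (fun t => f t * deriv f t) := by
    refine (hfc.mul hfc').integrable_of_hasCompactSupport ?_
    exact hsup'.mul_left (f := f)
  have hzero : ∫ t, f t * deriv f t = 0 := by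
    have := integral_eq_zero_of_hasDerivAt_of_integrable (f := fun t => f t ^ 2)
      (f' := fun t => 2 * (f t * deriv f t)) (fun t => by
        have := (hfd t).pow 2
        refine this.congr_deriv ?_
        simp; ring) (i3.const_mul 2) i1
    rw [integral_const_mul] at this
    linarith
  have hpos : 0 < ∫ t, f t ^ 2 := by
    refine (hfc.pow 2).integral_pos_of_hasCompactSupport_nonneg_nonzero ?_ (fun t => sq_nonneg _)
      (x := 0) ?_
    · have := hsup.mul_left (f := f)
      rwa [← pow_two] at this
    · have : f 0 = 1 := f.one_of_mem_closedBall (by simp [f])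
      simp [this]
  obtain ⟨k, hk, hkτ⟩ : ∃ k : ℝ, 0 < k ∧ (∫ t, deriv f t ^ 2) / k ^ 2 ≤ τ * ∫ t, f t ^ 2 := by
    have ht : Filter.Tendsto (fun k : ℝ => (∫ t, deriv f t ^ 2) / k ^ 2) Filter.atTop (nhds 0) :=
      Filter.Tendsto.const_div_atTop (Filter.tendsto_pow_atTop (by norm_num)) _
    obtain ⟨k, h1, h2⟩ := ((ht.eventually (ge_mem_nhds (mul_pos hτ hpos))).and
      (Filter.eventually_gt_atTop 0)).exists
    exact ⟨k, h2, h1⟩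
  refine ⟨k, hk, fun T => ?_⟩
  set p : ℝ → ℝ := fun r => r ^ (-α) * f ((Real.log r - T) / k) with hp
  have hpd : ∀ r, 0 < r → deriv p r = r ^ (-α - 1) *
      (deriv f ((Real.log r - T) / k) / k - α * f ((Real.log r - T) / k)) := fun r hr => by
    have h1 : HasDerivAt (fun r : ℝ => r ^ (-α)) (-α * r ^ (-α - 1)) r :=
      Real.hasDerivAt_rpow_const (Or.inl hr.ne')
    have h2 : HasDerivAt (fun r : ℝ => (Real.log r - T) / k) (r⁻¹ / k) r :=
      ((Real.hasDerivAt_log hr.ne').sub_const T).div_const k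
    have h3 := h1.mul ((hfd _).comp r h2)
    have h4 : deriv p r = _ := h3.deriv
    rw [h4]
    have : r ^ (-α) = r ^ (-α - 1) * r := by
      rw [Real.rpow_sub_one hr.ne']; field_simp
    simp only [Function.comp]
    rw [this]
    field_simp
    ring
  have hD1 : ∫ r in Set.Ioi (0:ℝ), r ^ (2 * α - 1) * p r ^ 2 = k * ∫ t, f t ^ 2 := by
    rw [integral_Ioi_exp, ← integral_affine _ T k hk]
    congr 1; ext t
    simp only [hp, Real.log_exp]
    rw [mul_pow, ← mul_assoc, ← mul_assoc, ← Real.exp_mul, ← Real.exp_mul, ← Real.exp_add,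
      ← Real.exp_nat_mul, ← Real.exp_add]
    have : t + t * (2 * α - 1) + (2 : ℕ) * (t * -α) = 0 := by push_cast; ring
    rw [this]; simp
  have hD2 : ∫ r in Set.Ioi (0:ℝ), r ^ (2 * α + 1) * deriv p r ^ 2 =
      k * ((∫ t, deriv f t ^ 2) / k ^ 2 + α ^ 2 * ∫ t, f t ^ 2) := by
    rw [integral_Ioi_exp]
    have : ∀ t, Real.exp t * (Real.exp t ^ (2 * α + 1) * deriv p (Real.exp t) ^ 2) =
        (fun t => (deriv f t / k - α * f t) ^ 2) ((t - T) / k) := fun t => by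
      rw [hpd _ (Real.exp_pos t)]
      simp only [Real.log_exp]
      rw [mul_pow, ← mul_assoc, ← mul_assoc, ← Real.exp_mul, ← Real.exp_mul, ← Real.exp_add,
        ← Real.exp_nat_mul, ← Real.exp_add]
      have : t + t * (2 * α + 1) + (2 : ℕ) * (t * (-α - 1)) = 0 := by push_cast; ring
      rw [this]; simp
    refine (integral_congr_ae (Filter.Eventually.of_forall this)).trans
      ((integral_affine (fun t => (deriv f t / k - α * f t) ^ 2) T k hk).trans ?_)
    congr 1
    have e : ∀ t, (deriv f t / k - α * f t) ^ 2 =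
      (1 / k ^ 2 * deriv f t ^ 2 + α ^ 2 * f t ^ 2) - (2 * α / k) * (f t * deriv f t) := fun t => by
      field_simp; ring
    simp_rw [e]
    have i12 : Integrable (fun t => 1 / k ^ 2 * deriv f t ^ 2 + α ^ 2 * f t ^ 2) :=
      (i2.const_mul _).add (i1.const_mul _)
    rw [integral_sub i12 (i3.const_mul _),
      integral_add (i2.const_mul _) (i1.const_mul _)]
    simp only [integral_const_mul, hzero]
    ring
  refine ⟨p, ?_, ?_, ?_, ?_⟩
  · intro r hr
    have hr' : r ≠ 0 := (Set.mem_Ioi.1 hr).ne'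
    apply ContDiffAt.contDiffWithinAt
    apply ContDiffAt.mul
    · exact Real.contDiffAt_rpow_const_of_ne hr'
    · apply hfs.contDiffAt.comp
      exact ((Real.contDiffAt_log.2 hr').sub contDiffAt_const).div_const k
  · intro r hr hnot
    have : f ((Real.log r - T) / k) = 0 := by
      apply f.zero_of_le_dist
      show (1:ℝ) ≤ _
      rw [Real.dist_eq, sub_zero, abs_div, abs_of_pos hk, le_div_iff₀ hk, one_mul]
      by_contra h
      rw [not_le, abs_lt] at h
      apply hnot
      constructor
      · rw [← Real.le_log_iff_exp_le hr]; linarith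
      · rw [← Real.log_le_iff_le_exp hr]; linarith
    simp [hp, this]
  · rw [hD1]; positivity
  · rw [hD1, hD2]
    have := mul_le_mul_of_nonneg_left hkτ hk.le
    nlinarith

section GradientCalculus

variable {E : Type*} [NormedAddCommGroup E] [InnerProductSpace ℝ E] [CompleteSpace E]

lemma hasGradientAt_mul' {f g : E → ℝ} {f' g' x : E} (hf : HasGradientAt f f' x)
    (hg : HasGradientAt g g' x) :
    HasGradientAt (fun y => f y * g y) (f x • g' + g x • f') x := by
  rw [hasGradientAt_iff_hasFDerivAt] at *
  have h : HasFDerivAt (fun y => f y * g y) _ x := hf.mul hg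
  refine h.congr_fderiv ?_
  simp

lemma hasGradientAt_comp' {h : ℝ → ℝ} {h' : ℝ} {f : E → ℝ} {f' x : E}
    (hh : HasDerivAt h h' (f x)) (hf : HasGradientAt f f' x) :
    HasGradientAt (fun y => h (f y)) (h' • f') x := by
  rw [hasGradientAt_iff_hasFDerivAt] at *
  have h : HasFDerivAt (fun y => h (f y)) _ x := hh.comp_hasFDerivAt x hf
  refine h.congr_fderiv ?_
  simp

lemma hasGradientAt_norm' {x : E} (hx : x ≠ 0) :
    HasGradientAt (fun y : E => ‖y‖) (‖x‖⁻¹ • x) x := by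
  rw [hasGradientAt_iff_hasFDerivAt]
  have h1 : HasFDerivAt (fun y : E => ‖y‖ ^ 2) (2 • innerSL ℝ x) x :=
    (hasStrictFDerivAt_norm_sq x).hasFDerivAt
  have h2 := h1.sqrt (by simpa using hx)
  simp only [Real.sqrt_sq (norm_nonneg _)] at h2
  refine h2.congr_fderiv ?_
  ext y
  simp [inner_smul_left]
  field_simp

end GradientCalculus

lemma hasGradientAt_coord {n : ℕ} [NeZero n] (x : EuclideanSpace ℝ (Fin n)) :
    HasGradientAt (fun y : EuclideanSpace ℝ (Fin n) => y 0) (EuclideanSpace.single 0 1) x := by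
  rw [hasGradientAt_iff_hasFDerivAt]
  have h : HasFDerivAt (fun y : EuclideanSpace ℝ (Fin n) => y 0) _ x :=
    (EuclideanSpace.proj (0 : Fin n) : EuclideanSpace ℝ (Fin n) →L[ℝ] ℝ).hasFDerivAt
  refine h.congr_fderiv ?_
  ext y
  simp [EuclideanSpace.inner_single_left]

lemma smooth_ext {E : Type*} [NormedAddCommGroup E] [NormedSpace ℝ E] {U K : Set E}
    (hU : IsOpen U) (hK : IsCompact K) (hKU : K ⊆ U) {Q : E → ℝ}
    (hQ : ContDiffOn ℝ (⊤ : ℕ∞) Q U) (h0 : ∀ x, x ∉ K → Q x = 0) :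
    ContDiff ℝ (⊤ : ℕ∞) Q ∧ HasCompactSupport Q ∧ tsupport Q ⊆ K := by
  have hts : tsupport Q ⊆ K := by
    apply closure_minimal _ hK.isClosed
    intro x hx
    by_contra h
    exact hx (h0 x h)
  refine ⟨?_, HasCompactSupport.intro hK h0, hts⟩
  rw [contDiff_iff_contDiffAt]
  intro x
  by_cases hx : x ∈ U
  · exact hQ.contDiffAt (hU.mem_nhds hx)
  · have : Q =ᶠ[nhds x] fun _ => 0 := by
      filter_upwards [hK.isClosed.isOpen_compl.mem_nhds (fun h => hx (hKU h))] with y hy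
      exact h0 y hy
    exact contDiffAt_const.congr_of_eventuallyEq this

/-- The truncated cone. -/
def Kset (n : ℕ) [NeZero n] (a b ε : ℝ) : Set (EuclideanSpace ℝ (Fin n)) :=
  {x | a ≤ ‖x‖ ∧ ‖x‖ ≤ b ∧ ε * ‖x‖ ≤ x 0}

lemma Kset_compact (n : ℕ) [NeZero n] (a b ε : ℝ) : IsCompact (Kset n a b ε) := by
  apply (isCompact_closedBall (0 : EuclideanSpace ℝ (Fin n)) b).of_isClosed_subset
  · apply (isClosed_le continuous_const continuous_norm).inter
    apply (isClosed_le continuous_norm continuous_const).inter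
    have h1 : Continuous (fun x : EuclideanSpace ℝ (Fin n) => ε * ‖x‖) := by fun_prop
    have h2 : Continuous (fun x : EuclideanSpace ℝ (Fin n) => x 0) := by fun_prop
    exact isClosed_le h1 h2
  · intro x hx
    simpa using hx.2.1

lemma Kset_sub (n : ℕ) [NeZero n] (a b ε : ℝ) (ha : 0 < a) (hε : 0 < ε) :
    Kset n a b ε ⊆ Hplus n := by
  intro x hx
  have h1 : 0 < ‖x‖ := ha.trans_le hx.1
  exact (mul_pos hε h1).trans_le hx.2.2

lemma Hplus_open (n : ℕ) [NeZero n] : IsOpen (Hplus n) :=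
  isOpen_lt continuous_const (by fun_prop)

lemma Hplus_ne {n : ℕ} [NeZero n] {x : EuclideanSpace ℝ (Fin n)} (hx : x ∈ Hplus n) : x ≠ 0 := by
  rintro rfl
  have : (0:ℝ) < (0 : EuclideanSpace ℝ (Fin n)) 0 := hx
  simp at this

lemma prod_zero {n : ℕ} [NeZero n] {a b ε : ℝ} (hε : 0 < ε) {A B : ℝ → ℝ}
    (hA : ∀ r, 0 < r → r ∉ Set.Icc a b → A r = 0) (hB : ∀ s ≤ ε, B s = 0)
    (x : EuclideanSpace ℝ (Fin n)) (hx : x ∉ Kset n a b ε) : A ‖x‖ * B (x 0 / ‖x‖) = 0 := by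
  rcases eq_or_ne x 0 with rfl | h0
  · rw [hB _ (by simpa using hε.le)]; simp
  have hr : 0 < ‖x‖ := norm_pos_iff.2 h0
  by_cases h1 : ‖x‖ ∈ Set.Icc a b
  · rw [hB _, mul_zero]
    rw [div_le_iff₀ hr]
    by_contra h
    exact hx ⟨h1.1, h1.2, (not_le.1 h).le⟩
  · rw [hA _ hr h1, zero_mul]

lemma prod_integrable {n : ℕ} [NeZero n] {a b ε : ℝ} (ha : 0 < a) (hε : 0 < ε) {A B : ℝ → ℝ}
    (hAc : ContinuousOn A (Set.Ioi 0)) (hBc : ContinuousOn B (Set.Ioi 0))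
    (hA : ∀ r, 0 < r → r ∉ Set.Icc a b → A r = 0) (hB : ∀ s ≤ ε, B s = 0) :
    Integrable (fun x : EuclideanSpace ℝ (Fin n) => A ‖x‖ * B (x 0 / ‖x‖)) := by
  rw [← integrableOn_iff_integrable_of_support_subset (s := Kset n a b ε)]
  · apply ContinuousOn.integrableOn_compact (Kset_compact n a b ε)
    have hpos : ∀ x ∈ Kset n a b ε, 0 < ‖x‖ := fun x hx => ha.trans_le hx.1
    apply ContinuousOn.mul
    · exact hAc.comp continuous_norm.continuousOn hpos
    · refine hBc.comp (ContinuousOn.div (by fun_prop) (by fun_prop) fun x hx => (hpos x hx).ne') ?_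
      intro x hx
      exact div_pos (Kset_sub n a b ε ha hε hx) (hpos x hx)
  · intro x hx
    by_contra h
    exact hx (prod_zero hε hA hB x h)

lemma prod_setIntegral {n : ℕ} [NeZero n] {a b ε : ℝ} (ha : 0 < a) (hε : 0 < ε) {A B : ℝ → ℝ}
    (hA : ∀ r, 0 < r → r ∉ Set.Icc a b → A r = 0) (hB : ∀ s ≤ ε, B s = 0) :
    ∫ x in Hplus n, A ‖x‖ * B (x 0 / ‖x‖) =
      (∫ r in Set.Ioi (0:ℝ), r ^ (n - 1) * A r) *
        ∫ θ : Metric.sphere (0 : EuclideanSpace ℝ (Fin n)) 1, B (θ.1 0)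
          ∂((volume : Measure (EuclideanSpace ℝ (Fin n))).toSphere) := by
  rw [← polar_prod]
  apply setIntegral_eq_integral_of_forall_compl_eq_zero
  intro x hx
  exact prod_zero hε hA hB x (fun h => hx (Kset_sub n a b ε ha hε h))

lemma integral_partial_zero {n : ℕ} [NeZero n] {v : EuclideanSpace ℝ (Fin n) → ℝ}
    (hv : ContDiff ℝ (⊤ : ℕ∞) v) (hc : HasCompactSupport v) (e : EuclideanSpace ℝ (Fin n)) :
    Integrable (fun x => fderiv ℝ v x e) ∧ ∫ x, fderiv ℝ v x e = 0 := by
  have hcd : Continuous (fun x => fderiv ℝ v x e) :=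
    (hv.continuous_fderiv (by simp)).clm_apply continuous_const
  have hi : Integrable (fun x => fderiv ℝ v x e) :=
    hcd.integrable_of_hasCompactSupport (hc.fderiv_apply ℝ e)
  refine ⟨hi, ?_⟩
  have := integral_mul_fderiv_eq_neg_fderiv_mul_of_integrable (μ := volume)
    (f := fun _ : EuclideanSpace ℝ (Fin n) => (1:ℝ)) (g := v) (v := e) (by simp)
    (by simpa using hi) (by simpa using hv.continuous.integrable_of_hasCompactSupport hc)
    (fun _ _ => differentiableAt_const _) (fun x _ => hv.differentiable (by simp) x)
  simpa using this

lemma norm_comb {n : ℕ} [NeZero n] (x : EuclideanSpace ℝ (Fin n)) (α γ : ℝ) :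
    ‖α • x + γ • (EuclideanSpace.single 0 1 : EuclideanSpace ℝ (Fin n))‖ ^ 2 =
      α ^ 2 * ‖x‖ ^ 2 + 2 * α * γ * x 0 + γ ^ 2 := by
  rw [norm_add_sq_real, norm_smul, norm_smul, inner_smul_left, inner_smul_right,
    EuclideanSpace.inner_single_right]
  simp [mul_pow]
  ring

lemma pointwise_energy {n : ℕ} [NeZero n] (β : ℝ) {p g : ℝ → ℝ}
    (hp : ContDiffOn ℝ (⊤ : ℕ∞) p (Set.Ioi 0)) (hg : ContDiff ℝ (⊤ : ℕ∞) g)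
    {x : EuclideanSpace ℝ (Fin n)} (hx : x ∈ Hplus n) :
    ‖gradient (fun y : EuclideanSpace ℝ (Fin n) => y 0 ^ β * (p ‖y‖ * g (y 0 / ‖y‖))) x‖ ^ 2
      - β * (1 - β) * ((x 0 ^ β * (p ‖x‖ * g (x 0 / ‖x‖))) ^ 2 / (x 0) ^ 2) ≤
    (‖x‖ ^ (2 * β) * deriv p ‖x‖ ^ 2) * ((x 0 / ‖x‖) ^ (2 * β) * g (x 0 / ‖x‖) ^ 2) +
    (‖x‖ ^ (2 * β - 2) * p ‖x‖ ^ 2) * ((x 0 / ‖x‖) ^ (2 * β) * deriv g (x 0 / ‖x‖) ^ 2) +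
    β * fderiv ℝ (fun y : EuclideanSpace ℝ (Fin n) =>
      y 0 ^ (2 * β - 1) * ((p ‖y‖ * g (y 0 / ‖y‖)) * (p ‖y‖ * g (y 0 / ‖y‖)))) x
        (EuclideanSpace.single 0 1) := by
  have hx0 : 0 < x 0 := hx
  have hne : x ≠ 0 := Hplus_ne hx
  have hr : 0 < ‖x‖ := norm_pos_iff.2 hne
  set e : EuclideanSpace ℝ (Fin n) := EuclideanSpace.single 0 1 with he
  have hpd : HasDerivAt p (deriv p ‖x‖) ‖x‖ :=
    ((hp.differentiableOn (by simp)).differentiableAt (Ioi_mem_nhds hr)).hasDerivAt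
  have hgd : HasDerivAt g (deriv g (x 0 * ‖x‖⁻¹)) (x 0 * ‖x‖⁻¹) :=
    (hg.differentiable (by simp) _).hasDerivAt
  have Gn := hasGradientAt_norm' hne
  have Gc : HasGradientAt (fun y : EuclideanSpace ℝ (Fin n) => y 0) e x := hasGradientAt_coord x
  have Gi := hasGradientAt_comp' (hasDerivAt_inv hr.ne') Gn
  have Gs := hasGradientAt_mul' Gc Gi
  have Gψ := hasGradientAt_mul' (hasGradientAt_comp' hpd Gn) (hasGradientAt_comp' hgd Gs)
  simp only [div_eq_mul_inv]
  have Gh := hasGradientAt_comp' (f := fun y : EuclideanSpace ℝ (Fin n) => y 0)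
    (Real.hasDerivAt_rpow_const (p := β) (Or.inl hx0.ne')) Gc
  have Gk := hasGradientAt_comp' (f := fun y : EuclideanSpace ℝ (Fin n) => y 0)
    (Real.hasDerivAt_rpow_const (p := 2 * β - 1) (Or.inl hx0.ne')) Gc
  have Gφ := hasGradientAt_mul' Gh Gψ
  have Gv := hasGradientAt_mul' Gk (hasGradientAt_mul' Gψ Gψ)
  have e1 : gradient (fun y : EuclideanSpace ℝ (Fin n) => y 0 ^ β * (p ‖y‖ * g (y 0 * ‖y‖⁻¹))) x
    = _ := Gφ.gradient
  have e2 : fderiv ℝ (fun y : EuclideanSpace ℝ (Fin n) =>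
      y 0 ^ (2 * β - 1) * ((p ‖y‖ * g (y 0 * ‖y‖⁻¹)) * (p ‖y‖ * g (y 0 * ‖y‖⁻¹)))) x e = _ :=
    Gv.fderiv_apply
  rw [e1, e2]
  -- name everything
  generalize hP : p ‖x‖ = P
  generalize hP' : deriv p ‖x‖ = P'
  generalize hG : g (x 0 * ‖x‖⁻¹) = G
  generalize hG' : deriv g (x 0 * ‖x‖⁻¹) = G'
  have hrw : (x 0 * ‖x‖⁻¹) ^ (2 * β) = x 0 ^ (2 * β) * (‖x‖ ^ (2 * β))⁻¹ := by
    rw [Real.mul_rpow hx0.le (by positivity), Real.inv_rpow hr.le]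
  have hR2 : ‖x‖ ^ (2 * β - 2) = ‖x‖ ^ (2 * β) / ‖x‖ ^ 2 := by
    rw [Real.rpow_sub hr]; norm_num
  have hRpos : 0 < ‖x‖ ^ (2 * β) := by positivity
  rw [hrw, hR2]
  generalize ‖x‖ ^ (2 * β) = W at hRpos
  generalize hY : x 0 ^ (β - 1) = Y
  have h1 : x 0 ^ β = Y * x 0 := by
    rw [← hY, Real.rpow_sub_one hx0.ne']; field_simp
  have h2 : x 0 ^ (2 * β - 1 - 1) = Y ^ 2 := by
    rw [← hY, ← Real.rpow_natCast, ← Real.rpow_mul hx0.le]; congr 1; push_cast; ring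
  have h3 : x 0 ^ (2 * β - 1) = Y ^ 2 * x 0 := by
    rw [← h2, Real.rpow_sub_one hx0.ne' (2 * β - 1)]; field_simp
  have h4 : x 0 ^ (2 * β) = Y ^ 2 * x 0 ^ 2 := by
    have : x 0 ^ (2 * β - 1) = x 0 ^ (2 * β) / x 0 := Real.rpow_sub_one hx0.ne' _
    rw [h3] at this
    field_simp at this
    linarith
  rw [h1, h2, h3, h4]
  generalize ht : x 0 = t at hx0
  generalize hrr : ‖x‖ = r at hr
  have hin : inner ℝ x e = t := by
    rw [he, EuclideanSpace.inner_single_right, ht]; simp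
  have hee : inner ℝ e e = (1:ℝ) := by
    rw [he, EuclideanSpace.inner_single_right]; simp
  have hgrad : (Y * t) • (P • G' • (t • -(r ^ 2)⁻¹ • r⁻¹ • x + r⁻¹ • e) + G • P' • r⁻¹ • x) +
      (P * G) • (β * Y) • e =
      (Y * t * (G * P' * r⁻¹ - P * G' * t * (r ^ 2)⁻¹ * r⁻¹)) • x +
        (Y * t * P * G' * r⁻¹ + P * G * β * Y) • e := by
    module
  have hlhs := norm_comb x (Y * t * (G * P' * r⁻¹ - P * G' * t * (r ^ 2)⁻¹ * r⁻¹))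
    (Y * t * P * G' * r⁻¹ + P * G * β * Y)
  rw [← he, ← hgrad, ht, hrr] at hlhs
  simp only [hlhs, inner_add_left, inner_smul_left, hin, hee, conj_trivial]
  have key : 0 ≤ Y ^ 2 * t ^ 2 * P ^ 2 * G' ^ 2 * t ^ 2 / r ^ 4 := by positivity
  rw [← sub_nonneg]
  refine key.trans (le_of_eq ?_)
  field_simp
  ring

lemma int_combine {E : Type*} [MeasureSpace E] {S : Set E} (hS : MeasurableSet S) (c d : ℝ)
    {G W P Q D : E → ℝ} (hG : IntegrableOn G S) (hW : IntegrableOn W S) (hP : IntegrableOn P S)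
    (hQ : IntegrableOn Q S) (hD : IntegrableOn D S) (hD0 : ∫ x in S, D x = 0)
    (h : ∀ x ∈ S, G x - c * W x ≤ P x + Q x + d * D x) :
    (∫ x in S, G x) - c * (∫ x in S, W x) ≤ (∫ x in S, P x) + ∫ x in S, Q x := by
  have hPQ : IntegrableOn (fun x => P x + Q x) S := hP.add hQ
  have h1 : ∫ x in S, (G x - c * W x) = (∫ x in S, G x) - c * (∫ x in S, W x) := by
    rw [integral_sub hG (hW.const_mul c), integral_const_mul]
  have h2 : ∫ x in S, (P x + Q x + d * D x) = (∫ x in S, P x) + ∫ x in S, Q x := by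
    rw [integral_add hPQ (hD.const_mul d), integral_add hP hQ, integral_const_mul, hD0]
    simp
  rw [← h1, ← h2]
  exact setIntegral_mono_on (hG.sub (hW.const_mul c)) (hPQ.add (hD.const_mul d)) hS h

set_option maxHeartbeats 1600000 in
lemma energy {n : ℕ} [NeZero n] (β : ℝ) {p g : ℝ → ℝ} {a b ε : ℝ} (ha : 0 < a) (hε : 0 < ε)
    (hp : ContDiffOn ℝ (⊤ : ℕ∞) p (Set.Ioi 0)) (hg : ContDiff ℝ (⊤ : ℕ∞) g)
    (hp0 : ∀ r, 0 < r → r ∉ Set.Icc a b → p r = 0) (hg0 : ∀ s ≤ ε, g s = 0)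
    (φ : EuclideanSpace ℝ (Fin n) → ℝ)
    (hφ : φ = fun y => y 0 ^ β * (p ‖y‖ * g (y 0 / ‖y‖))) :
    IsTestFun (Hplus n) φ ∧ (∀ x ∈ tsupport φ, a ≤ ‖x‖ ∧ ‖x‖ ≤ b) ∧
    (∫ x in Hplus n, (φ x) ^ 2 / ‖x‖ ^ 2) =
      (∫ r in Set.Ioi (0:ℝ), r ^ (n - 1) * (r ^ (2 * β - 2) * p r ^ 2)) *
        (∫ θ : Metric.sphere (0 : EuclideanSpace ℝ (Fin n)) 1, (θ.1 0) ^ (2 * β) * g (θ.1 0) ^ 2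
          ∂((volume : Measure (EuclideanSpace ℝ (Fin n))).toSphere)) ∧
    (∫ x in Hplus n, ‖gradient φ x‖ ^ 2) - β * (1 - β) * (∫ x in Hplus n, (φ x) ^ 2 / (x 0) ^ 2) ≤
      (∫ r in Set.Ioi (0:ℝ), r ^ (n - 1) * (r ^ (2 * β) * deriv p r ^ 2)) *
        (∫ θ : Metric.sphere (0 : EuclideanSpace ℝ (Fin n)) 1, (θ.1 0) ^ (2 * β) * g (θ.1 0) ^ 2
          ∂((volume : Measure (EuclideanSpace ℝ (Fin n))).toSphere)) +
      (∫ r in Set.Ioi (0:ℝ), r ^ (n - 1) * (r ^ (2 * β - 2) * p r ^ 2)) *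
        (∫ θ : Metric.sphere (0 : EuclideanSpace ℝ (Fin n)) 1,
          (θ.1 0) ^ (2 * β) * deriv g (θ.1 0) ^ 2
          ∂((volume : Measure (EuclideanSpace ℝ (Fin n))).toSphere)) := by
  have hHo := Hplus_open n
  have hHm : MeasurableSet (Hplus n) := hHo.measurableSet
  have hKc := Kset_compact n a b ε
  have hKs := Kset_sub n a b ε ha hε
  have hψ0 := prod_zero (n := n) hε hp0 hg0
  -- smoothness of `ψ`
  have hnorm : ContDiffOn ℝ (⊤ : ℕ∞) (fun y : EuclideanSpace ℝ (Fin n) => ‖y‖) (Hplus n) :=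
    fun x hx => (contDiffAt_norm ℝ (Hplus_ne hx)).contDiffWithinAt
  have hcoord : ContDiffOn ℝ (⊤ : ℕ∞) (fun y : EuclideanSpace ℝ (Fin n) => y 0) (Hplus n) :=
    (EuclideanSpace.proj (0 : Fin n) : EuclideanSpace ℝ (Fin n) →L[ℝ] ℝ).contDiff.contDiffOn
  have hψs : ContDiffOn ℝ (⊤ : ℕ∞)
      (fun y : EuclideanSpace ℝ (Fin n) => p ‖y‖ * g (y 0 / ‖y‖)) (Hplus n) := by
    apply ContDiffOn.mul
    · exact hp.comp hnorm fun x hx => norm_pos_iff.2 (Hplus_ne hx)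
    · exact hg.comp_contDiffOn (hcoord.div hnorm fun x hx => (norm_pos_iff.2 (Hplus_ne hx)).ne')
  have hpow : ∀ q : ℝ, ContDiffOn ℝ (⊤ : ℕ∞)
      (fun y : EuclideanSpace ℝ (Fin n) => (y 0) ^ q) (Hplus n) := fun q =>
    hcoord.rpow_const_of_ne fun x hx => (show 0 < x 0 from hx).ne'
  obtain ⟨hφ1, hφ2, hφ3⟩ := smooth_ext hHo hKc hKs ((hpow β).mul hψs)
    (fun x hx => by simp [hψ0 x hx])
  obtain ⟨hv1, hv2, hv3⟩ := smooth_ext hHo hKc hKs ((hpow (2 * β - 1)).mul (hψs.mul hψs))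
    (fun x hx => by simp [hψ0 x hx])
  -- facts on derivatives
  have hp'c : ContinuousOn (deriv p) (Set.Ioi 0) :=
    hp.continuousOn_deriv_of_isOpen isOpen_Ioi (by simp)
  have hp'0 : ∀ r, 0 < r → r ∉ Set.Icc a b → deriv p r = 0 := fun r hr hr' => by
    have : p =ᶠ[nhds r] fun _ => 0 := by
      filter_upwards [Ioi_mem_nhds hr, isClosed_Icc.isOpen_compl.mem_nhds hr'] with y hy hy'
      exact hp0 y hy hy'
    rw [this.deriv_eq]; simp
  have hg'c : Continuous (deriv g) :=
    (hg.of_le (by simp : (1 : WithTop ℕ∞) ≤ _)).continuous_deriv le_rfl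
  have hg'0 : ∀ s ≤ ε / 2, deriv g s = 0 := fun s hs => by
    have : g =ᶠ[nhds s] fun _ => 0 := by
      filter_upwards [Iio_mem_nhds (by linarith : s < ε)] with y hy
      exact hg0 y (le_of_lt hy)
    rw [this.deriv_eq]; simp
  have hrp : ∀ q : ℝ, ContinuousOn (fun r : ℝ => r ^ q) (Set.Ioi 0) := fun q r hr =>
    (Real.continuousAt_rpow_const r q (Or.inl (Set.mem_Ioi.1 hr).ne')).continuousWithinAt
  have hε2 : 0 < ε / 2 := by linarith
  -- pieces
  have a1 : ∀ r, 0 < r → r ∉ Set.Icc a b → r ^ (2 * β - 2) * p r ^ 2 = 0 :=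
    fun r h h' => by rw [hp0 r h h']; simp
  have a2 : ∀ r, 0 < r → r ∉ Set.Icc a b → r ^ (2 * β) * deriv p r ^ 2 = 0 :=
    fun r h h' => by rw [hp'0 r h h']; simp
  have b1 : ∀ s ≤ ε, s ^ (2 * β) * g s ^ 2 = 0 := fun s h => by rw [hg0 s h]; simp
  have b2 : ∀ s ≤ ε / 2, s ^ (2 * β) * deriv g s ^ 2 = 0 := fun s h => by rw [hg'0 s h]; simp
  have b3 : ∀ s ≤ ε, s ^ (2 * β - 2) * g s ^ 2 = 0 := fun s h => by rw [hg0 s h]; simp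
  have c1 : ContinuousOn (fun r => r ^ (2 * β - 2) * p r ^ 2) (Set.Ioi 0) :=
    (hrp _).mul (hp.continuousOn.pow 2)
  have c2 : ContinuousOn (fun r => r ^ (2 * β) * deriv p r ^ 2) (Set.Ioi 0) :=
    (hrp _).mul (hp'c.pow 2)
  have d1 : ContinuousOn (fun r => r ^ (2 * β) * g r ^ 2) (Set.Ioi 0) :=
    (hrp _).mul (hg.continuous.continuousOn.pow 2)
  have d2 : ContinuousOn (fun r => r ^ (2 * β) * deriv g r ^ 2) (Set.Ioi 0) :=
    (hrp _).mul (hg'c.continuousOn.pow 2)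
  have d3 : ContinuousOn (fun r => r ^ (2 * β - 2) * g r ^ 2) (Set.Ioi 0) :=
    (hrp _).mul (hg.continuous.continuousOn.pow 2)
  have I2 := prod_integrable (n := n) ha hε c2 d1 a2 b1
  have I3 := prod_integrable (n := n) ha hε2 c1 d2 a1 b2
  have I4 := prod_integrable (n := n) ha hε c1 d3 a1 b3
  have E1 := prod_setIntegral (n := n) ha hε a1 b1
  have E2 := prod_setIntegral (n := n) ha hε a2 b1
  have E3 := prod_setIntegral (n := n) ha hε2 a1 b2
  obtain ⟨Iv, Ev⟩ := integral_partial_zero hv1 hv2 (EuclideanSpace.single 0 1)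
  have hpt := fun (x : EuclideanSpace ℝ (Fin n)) (hx : x ∈ Hplus n) =>
    pointwise_energy (n := n) β hp hg hx
  rw [← hφ] at hφ1 hφ2 hφ3 hpt
  set v : EuclideanSpace ℝ (Fin n) → ℝ := (fun y : EuclideanSpace ℝ (Fin n) =>
      y 0 ^ (2 * β - 1) * ((p ‖y‖ * g (y 0 / ‖y‖)) * (p ‖y‖ * g (y 0 / ‖y‖)))) with hv
  have Ev' : ∫ x in Hplus n, fderiv ℝ v x (EuclideanSpace.single 0 1) = 0 := by
    rw [← Ev]
    apply setIntegral_eq_integral_of_forall_compl_eq_zero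
    intro x hx
    have : x ∉ tsupport v := fun h => hx (hKs (hv3 h))
    have h0 : fderiv ℝ v x = 0 := by
      by_contra h
      exact this (support_fderiv_subset ℝ h)
    rw [h0]; simp
  refine ⟨⟨hφ1, hφ2, hφ3.trans hKs⟩, fun x hx => ⟨(hφ3 hx).1, (hφ3 hx).2.1⟩, ?_, ?_⟩
  · rw [← E1]
    apply setIntegral_congr_fun hHm
    intro x hx
    have hx0 : 0 < x 0 := hx
    have hr : 0 < ‖x‖ := norm_pos_iff.2 (Hplus_ne hx)
    simp only [hφ]
    rw [Real.div_rpow hx0.le hr.le, Real.rpow_sub hr, Real.rpow_two, mul_pow,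
      two_mul β, Real.rpow_add hx0]
    have := Real.rpow_pos_of_pos hr (β + β)
    field_simp
  · have Ig : Integrable (fun x => ‖gradient φ x‖ ^ 2) := by
      have hn : ∀ x, ‖gradient φ x‖ = ‖fderiv ℝ φ x‖ := fun x => by
        simp [gradient]
      simp_rw [hn]
      have hc : Continuous (fun x => fderiv ℝ φ x) := hφ1.continuous_fderiv (by simp)
      refine (hc.norm.pow 2).integrable_of_hasCompactSupport ?_
      have := hφ2.fderiv ℝ
      exact this.comp_left (g := fun L => ‖L‖ ^ 2) (by simp)
    have I4' : IntegrableOn (fun x => (φ x) ^ 2 / (x 0) ^ 2) (Hplus n) := by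
      refine (integrableOn_congr_fun ?_ hHm).1 I4.integrableOn
      intro x hx
      have hx0 : 0 < x 0 := hx
      have hr : 0 < ‖x‖ := norm_pos_iff.2 (Hplus_ne hx)
      simp only [hφ]
      rw [Real.div_rpow hx0.le hr.le, Real.rpow_sub hx0, Real.rpow_two, mul_pow (x 0 ^ β),
        two_mul β, Real.rpow_add hx0]
      have := Real.rpow_pos_of_pos hr (β + β - 2)
      field_simp
    rw [← E2, ← E3]
    refine int_combine hHm (β * (1 - β)) β Ig.integrableOn I4' I2.integrableOn I3.integrableOn
      Iv.integrableOn Ev' ?_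
    intro x hx
    have hφx : φ x = x 0 ^ β * (p ‖x‖ * g (x 0 / ‖x‖)) := by rw [hφ]
    have h := hpt x hx
    rw [← hφx] at h
    exact h

lemma core_bound {n : ℕ} [NeZero n] (μ : ℝ) (hμ : μ ≤ 1 / 4) (lam : ℝ)
    (Reg : Set (EuclideanSpace ℝ (Fin n)))
    (hreg : ∀ k : ℝ, 0 < k → ∃ T : ℝ, ∀ x : EuclideanSpace ℝ (Fin n),
      Real.exp (T - k) ≤ ‖x‖ → ‖x‖ ≤ Real.exp (T + k) → x ∈ Reg)
    (H : ∀ φ : EuclideanSpace ℝ (Fin n) → ℝ, IsTestFun (Hplus n) φ →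
        tsupport φ ⊆ Reg →
        lam * ∫ x in Hplus n, (φ x) ^ 2 / ‖x‖ ^ 2 ≤
          (∫ x in Hplus n, ‖gradient φ x‖ ^ 2)
            - μ * ∫ x in Hplus n, (φ x) ^ 2 / (x 0) ^ 2) :
    lam ≤ ((n : ℝ) - 1 + Real.sqrt (1 - 4 * μ)) ^ 2 / 4 := by
  set q := Real.sqrt (1 - 4 * μ) with hq
  have hq0 : 0 ≤ q := Real.sqrt_nonneg _
  have hq2 : q ^ 2 = 1 - 4 * μ := Real.sq_sqrt (by linarith)
  have main : ∀ s, q < s → lam ≤ ((n : ℝ) - 1 + s) ^ 2 / 4 := by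
    intro s hs
    set β := (1 + s) / 2 with hβ
    have hβ1 : 1 / 2 < β := by rw [hβ]; linarith
    have hβμ : β * (1 - β) ≤ μ := by
      rw [hβ]; nlinarith
    set α := ((n : ℝ) - 1 + s) / 2 with hα
    have hα2 : ((n : ℝ) - 1 + s) ^ 2 / 4 = α ^ 2 := by rw [hα]; ring
    rw [hα2]
    obtain ⟨c, hc, hcut⟩ := sphere_cutoff (n := n) β hβ1
    apply le_of_forall_pos_le_add
    intro τ hτ
    obtain ⟨g, ε, hg, hε, hg0, hgc, hgτ⟩ := hcut (τ / 2 * c) (by positivity)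
    obtain ⟨k, hk, hrad⟩ := radial_cutoff α (τ / 2) (by linarith)
    obtain ⟨T, hT⟩ := hreg k hk
    obtain ⟨p, hp, hp0, hD1, hD2⟩ := hrad T
    obtain ⟨h1, h2, h3, h4⟩ := energy (n := n) β (Real.exp_pos _) hε hp hg hp0 hg0 _ rfl
    have h5 := H _ h1 (fun x hx => hT x (h2 x hx).1 (h2 x hx).2)
    have hn : ((n - 1 : ℕ) : ℝ) = (n : ℝ) - 1 := by
      rw [Nat.cast_sub (Nat.one_le_iff_ne_zero.2 (NeZero.ne n))]; simp
    have e1 : ∫ r in Set.Ioi (0:ℝ), r ^ (n - 1) * (r ^ (2 * β - 2) * p r ^ 2) =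
        ∫ r in Set.Ioi (0:ℝ), r ^ (2 * α - 1) * p r ^ 2 := by
      apply setIntegral_congr_fun measurableSet_Ioi
      intro r hr
      simp only
      rw [← mul_assoc, ← Real.rpow_natCast, ← Real.rpow_add hr, hn]
      congr 2
      rw [hα, hβ]; ring
    have e2 : ∫ r in Set.Ioi (0:ℝ), r ^ (n - 1) * (r ^ (2 * β) * deriv p r ^ 2) =
        ∫ r in Set.Ioi (0:ℝ), r ^ (2 * α + 1) * deriv p r ^ 2 := by
      apply setIntegral_congr_fun measurableSet_Ioi
      intro r hr
      simp only
      rw [← mul_assoc, ← Real.rpow_natCast, ← Real.rpow_add hr, hn]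
      congr 2
      rw [hα, hβ]; ring
    rw [e1, e2] at h4
    rw [e1] at h3
    rw [h3] at h5
    have hpos : 0 ≤ ∫ x in Hplus n, (x 0 ^ β * (p ‖x‖ * g (x 0 / ‖x‖))) ^ 2 / (x 0) ^ 2 :=
      integral_nonneg fun x => by positivity
    have h6 := mul_le_mul_of_nonneg_right hβμ hpos
    set D1 := ∫ r in Set.Ioi (0:ℝ), r ^ (2 * α - 1) * p r ^ 2
    set D2 := ∫ r in Set.Ioi (0:ℝ), r ^ (2 * α + 1) * deriv p r ^ 2
    set C1 := ∫ θ : Metric.sphere (0 : EuclideanSpace ℝ (Fin n)) 1,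
      (θ.1 0) ^ (2 * β) * g (θ.1 0) ^ 2
        ∂((volume : Measure (EuclideanSpace ℝ (Fin n))).toSphere)
    set C2 := ∫ θ : Metric.sphere (0 : EuclideanSpace ℝ (Fin n)) 1,
      (θ.1 0) ^ (2 * β) * deriv g (θ.1 0) ^ 2
        ∂((volume : Measure (EuclideanSpace ℝ (Fin n))).toSphere)
    have hC1 : 0 < C1 := hc.trans_le hgc
    have h7 : lam * (D1 * C1) ≤ D2 * C1 + D1 * C2 := by linarith
    have h8 : D2 * C1 ≤ (α ^ 2 + τ / 2) * D1 * C1 := mul_le_mul_of_nonneg_right hD2 hC1.le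
    have h9 : D1 * C2 ≤ D1 * (τ / 2 * C1) := by
      apply mul_le_mul_of_nonneg_left _ hD1.le
      exact hgτ.trans (mul_le_mul_of_nonneg_left hgc (by linarith))
    have h10 : lam * (D1 * C1) ≤ (α ^ 2 + τ) * (D1 * C1) := by linarith
    exact le_of_mul_le_mul_right h10 (mul_pos hD1 hC1)
  have ht : Filter.Tendsto (fun s : ℝ => ((n : ℝ) - 1 + s) ^ 2 / 4) (nhdsWithin q (Set.Ioi q))
      (nhds (((n : ℝ) - 1 + q) ^ 2 / 4)) := by
    have : Continuous (fun s : ℝ => ((n : ℝ) - 1 + s) ^ 2 / 4) := by fun_prop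
    exact (this.tendsto q).mono_left nhdsWithin_le_nhds
  exact ge_of_tendsto ht (by filter_upwards [self_mem_nhdsWithin] with s hs using main s hs)

/-- `η(μ)²/4` is the best Hardy constant both near the origin and near infinity in the
half-space: if the inequality with constant `lam` holds for all test functions supported
in `B(0,R)`, or for all test functions supported outside `closure (B(0,R))`, then
`lam ≤ η(μ)²/4`. -/
theorem halfspace_best_constant_local {n : ℕ} [NeZero n] (hn : 2 ≤ n) (μ : ℝ)
    (hμ : μ ≤ 1 / 4) (R : ℝ) (hR : 0 < R) (lam : ℝ) :
    ((∀ φ : EuclideanSpace ℝ (Fin n) → ℝ, IsTestFun (Hplus n) φ →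
        tsupport φ ⊆ Metric.ball 0 R →
        lam * ∫ x in Hplus n, (φ x) ^ 2 / ‖x‖ ^ 2 ≤
          (∫ x in Hplus n, ‖gradient φ x‖ ^ 2)
            - μ * ∫ x in Hplus n, (φ x) ^ 2 / (x 0) ^ 2) →
      lam ≤ ((n : ℝ) - 1 + Real.sqrt (1 - 4 * μ)) ^ 2 / 4) ∧
    ((∀ φ : EuclideanSpace ℝ (Fin n) → ℝ, IsTestFun (Hplus n) φ →
        tsupport φ ⊆ (Metric.closedBall 0 R)ᶜ →
        lam * ∫ x in Hplus n, (φ x) ^ 2 / ‖x‖ ^ 2 ≤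
          (∫ x in Hplus n, ‖gradient φ x‖ ^ 2)
            - μ * ∫ x in Hplus n, (φ x) ^ 2 / (x 0) ^ 2) →
      lam ≤ ((n : ℝ) - 1 + Real.sqrt (1 - 4 * μ)) ^ 2 / 4) := by
  refine ⟨fun H => ?_, fun H => ?_⟩
  · refine core_bound μ hμ lam (Metric.ball 0 R) (fun k hk => ⟨Real.log R - k - 1, ?_⟩) H
    intro x _ hx
    have : Real.exp (Real.log R - k - 1 + k) < R := by
      rw [← Real.lt_log_iff_exp_lt hR]; linarith
    simpa using hx.trans_lt this
  · refine core_bound μ hμ lam (Metric.closedBall 0 R)ᶜ (fun k hk => ⟨Real.log R + k + 1, ?_⟩) H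
    intro x hx _
    have : R < Real.exp (Real.log R + k + 1 - k) := by
      rw [← Real.log_lt_iff_lt_exp hR]; linarith
    simpa using this.trans_le hx
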